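/- arXiv:cond-mat/0108388 — 2 statements merged into one kernel-verified Lean document; each statement's English description precedes it below -/
import Mathlib

section
/- Dissipation-induced instability: Let M, S, V, R be real n×n matrices with M symmetric positive definite, S skew-symmetric, V symmetric and invertible with at least one negative eigenvalue, and R symmetric positive definite. Then there exists ε₀ > 0 such that for every ε with 0 < ε < ε₀, there exists λ ∈ ℂ with Re λ > 0 and det(λ²M + λ(S + εR) + V) = 0; i.e. the perturbed Chetaev system Mq̈ + (S + εR)q̇ + Vq = 0 is spectrally unstable. -/
open Matrix Filter Topology

/-- In finite dimension, an operator all of whose eigenvalues have modulus less than one has a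
positive power of norm less than one. -/
lemma exists_pow_norm_lt_one {E : Type*} [NormedAddCommGroup E] [NormedSpace ℂ E]
    [FiniteDimensional ℂ E] [Nontrivial E] (B : Module.End ℂ E)
    (hB : ∀ (μ : ℂ) (x : E), x ≠ 0 → B x = μ • x → ‖μ‖ < 1) :
    ∃ k : ℕ, ‖Module.End.toContinuousLinearMap E (B ^ k)‖ < 1 := by
  haveI : CompleteSpace E := FiniteDimensional.complete ℂ E
  have hr : spectralRadius ℂ (Module.End.toContinuousLinearMap E B) < ((1 : NNReal) : ENNReal) := by
    apply spectrum.spectralRadius_lt_of_forall_lt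
    intro μ hμ
    rw [AlgEquiv.spectrum_eq] at hμ
    obtain ⟨x, hx⟩ := (Module.End.HasEigenvalue.of_mem_spectrum hμ).exists_hasEigenvector
    have := hB μ x hx.2 hx.apply_eq_smul
    exact_mod_cast this
  have ht := spectrum.pow_nnnorm_pow_one_div_tendsto_nhds_spectralRadius
    (Module.End.toContinuousLinearMap E B)
  have he := (ht.eventually (gt_mem_nhds hr)).and (eventually_ge_atTop 1)
  obtain ⟨k, hk, hk1⟩ := he.exists
  refine ⟨k, ?_⟩
  rw [map_pow]
  by_contra hcon
  push Not at hcon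
  have h1 : (1 : ENNReal) ≤ (‖Module.End.toContinuousLinearMap E B ^ k‖₊ : ENNReal) := by
    exact_mod_cast hcon
  have h2 : (1 : ENNReal) ≤
      (‖Module.End.toContinuousLinearMap E B ^ k‖₊ : ENNReal) ^ (1 / k : ℝ) :=
    ENNReal.one_le_rpow h1 (by positivity)
  exact absurd hk (not_lt.mpr h2)

/-- Lyapunov-type lemma via the Cayley transform. -/
lemma lyapunov_nonneg {E : Type*} [NormedAddCommGroup E] [NormedSpace ℂ E]
    [FiniteDimensional ℂ E] [Nontrivial E] (A : Module.End ℂ E)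
    (hA : ∀ (μ : ℂ) (x : E), x ≠ 0 → A x = μ • x → μ.re < 0)
    (F : E → ℝ) (hF : Continuous F) (hF0 : F 0 = 0)
    (hmono : ∀ u, F (u + A u) ≤ F (u - A u)) (x : E) : 0 ≤ F x := by
  have hinj : Function.Injective (1 - A : Module.End ℂ E) := by
    rw [← LinearMap.ker_eq_bot, LinearMap.ker_eq_bot']
    intro m hm
    by_contra hne
    have := hA 1 m hne (by
      simp only [LinearMap.sub_apply, Module.End.one_apply] at hm
      rw [one_smul]; exact (sub_eq_zero.mp hm).symm)
    norm_num at this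
  let e := LinearEquiv.ofInjectiveEndo (1 - A : Module.End ℂ E) hinj
  let B : Module.End ℂ E := (1 + A) * e.symm.toLinearMap
  have he : ∀ y, y - A y = e y := fun y => by simp [e]
  have hBe : ∀ y, B (y - A y) = y + A y := by
    intro y
    simp [B, he]
  have hsurj : ∀ x, ∃ y, x = y - A y := fun x => ⟨e.symm x, by rw [he]; simp⟩
  have hstep : ∀ x, F (B x) ≤ F x := by
    intro x
    obtain ⟨y, rfl⟩ := hsurj x
    rw [hBe]; exact hmono y
  have hpow : ∀ (k : ℕ) x, F ((B ^ k) x) ≤ F x := by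
    intro k
    induction k with
    | zero => intro x; simp
    | succ k ih =>
      intro x
      rw [pow_succ, Module.End.mul_apply]
      exact (ih _).trans (hstep x)
  have hBeig : ∀ (μ : ℂ) (x : E), x ≠ 0 → B x = μ • x → ‖μ‖ < 1 := by
    intro μ x hx hμ
    obtain ⟨y, rfl⟩ := hsurj x
    rw [hBe] at hμ
    have hy : y ≠ 0 := by rintro rfl; simp at hx
    have h1 : (μ + 1) • A y = (μ - 1) • y := by
      have h0 : A y = μ • y - μ • A y - y := by
        rw [← smul_sub, ← hμ]; abel
      rw [add_smul, sub_smul, one_smul, one_smul]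
      nth_rewrite 2 [h0]
      abel
    have hμ1 : μ + 1 ≠ 0 := by
      intro h0
      rw [h0, zero_smul] at h1
      have h2 : μ - 1 = 0 := (smul_eq_zero.mp h1.symm).resolve_right hy
      have : (2 : ℂ) = 0 := by linear_combination h0 - h2
      norm_num at this
    have h3 : A y = ((μ - 1) / (μ + 1)) • y := by
      rw [div_eq_inv_mul, mul_smul, ← h1, smul_smul, inv_mul_cancel₀ hμ1, one_smul]
    have h4 := hA _ y hy h3
    have hpos : 0 < Complex.normSq (μ + 1) := Complex.normSq_pos.mpr hμ1
    rw [Complex.div_re, ← add_div, div_neg_iff] at h4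
    have h5 : (μ - 1).re * (μ + 1).re + (μ - 1).im * (μ + 1).im < 0 := by
      rcases h4 with h | h
      · linarith [h.2]
      · exact h.1
    simp at h5
    have h6 : ‖μ‖ ^ 2 < 1 := by
      rw [Complex.sq_norm, Complex.normSq_apply]
      nlinarith
    nlinarith [norm_nonneg μ]
  obtain ⟨k, hk⟩ := exists_pow_norm_lt_one B hBeig
  have ht := tendsto_pow_atTop_nhds_zero_of_norm_lt_one hk
  have ht2 : Tendsto (fun m : ℕ => ((B ^ k) ^ m) x) atTop (𝓝 0) := by
    have h := ((ContinuousLinearMap.apply ℂ E x).continuous.tendsto 0).comp ht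
    have h0 : (ContinuousLinearMap.apply ℂ E x) 0 = 0 := by simp
    rw [h0] at h
    refine h.congr fun m => ?_
    simp only [Function.comp_apply, ContinuousLinearMap.apply_apply, ← map_pow]
    rfl
  have ht3 := (hF.tendsto 0).comp ht2
  rw [hF0] at ht3
  refine le_of_tendsto ht3 (Eventually.of_forall fun m => ?_)
  simp only [Function.comp_apply, ← pow_mul]
  exact hpow _ x

lemma re_form {n : ℕ} (R : Matrix (Fin n) (Fin n) ℝ) (y : Fin n → ℂ) :
    (star y ⬝ᵥ (R.map Complex.ofReal *ᵥ y)).re =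
      (fun i => (y i).re) ⬝ᵥ (R *ᵥ fun i => (y i).re) +
      (fun i => (y i).im) ⬝ᵥ (R *ᵥ fun i => (y i).im) := by
  simp only [dotProduct, mulVec, Complex.re_sum, Complex.im_sum, Matrix.map_apply, Pi.star_apply,
    Complex.mul_re, Complex.mul_im, ← Finset.sum_add_distrib]
  refine Finset.sum_congr rfl fun i _ => ?_
  simp

lemma re_form_pos {n : ℕ} {R : Matrix (Fin n) (Fin n) ℝ} (hR : R.PosDef) {y : Fin n → ℂ}
    (hy : y ≠ 0) : 0 < (star y ⬝ᵥ (R.map Complex.ofReal *ᵥ y)).re := by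
  rw [re_form]
  have hnn : ∀ v : Fin n → ℝ, 0 ≤ v ⬝ᵥ (R *ᵥ v) := fun v => by
    simpa using hR.posSemidef.re_dotProduct_nonneg v
  have hp : ∀ v : Fin n → ℝ, v ≠ 0 → 0 < v ⬝ᵥ (R *ᵥ v) := fun v hv => by
    simpa using hR.re_dotProduct_pos hv
  by_cases h : (fun i => (y i).re) = 0
  · have h2 : (fun i => (y i).im) ≠ 0 := by
      intro h2
      apply hy
      funext i
      exact Complex.ext (congrFun h i) (congrFun h2 i)
    linarith [hnn (fun i => (y i).re), hp _ h2]
  · linarith [hnn (fun i => (y i).im), hp _ h]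

lemma form_conj {n : ℕ} (N : Matrix (Fin n) (Fin n) ℝ) (a b : Fin n → ℂ) :
    star (star a ⬝ᵥ (N.map Complex.ofReal *ᵥ b)) = star b ⬝ᵥ (Nᵀ.map Complex.ofReal *ᵥ a) := by
  have h : (N.map Complex.ofReal)ᴴ = Nᵀ.map Complex.ofReal := by
    ext i j; simp
  rw [star_dotProduct, star_star, star_mulVec, h, ← dotProduct_mulVec]

/-- The first-order form of the system. -/
noncomputable def sysA {n : ℕ} (M G V : Matrix (Fin n) (Fin n) ℂ) :
    Module.End ℂ ((Fin n → ℂ) × (Fin n → ℂ)) :=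
  LinearMap.prod (LinearMap.snd ℂ _ _)
    (-((M⁻¹).mulVecLin ∘ₗ (G.mulVecLin ∘ₗ LinearMap.snd ℂ _ _ +
      V.mulVecLin ∘ₗ LinearMap.fst ℂ _ _)))

lemma sysA_fst {n : ℕ} (M G V : Matrix (Fin n) (Fin n) ℂ) (u) : (sysA M G V u).1 = u.2 := rfl

lemma sysA_snd {n : ℕ} (M G V : Matrix (Fin n) (Fin n) ℂ) (hM : IsUnit M.det) (u) :
    M *ᵥ (sysA M G V u).2 = -(G *ᵥ u.2 + V *ᵥ u.1) := by
  simp [sysA, mulVec_neg, mulVec_add, mulVec_mulVec, mul_nonsing_inv_cancel_left _ _ hM]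

/-- Dissipation-induced instability: if M is symmetric positive definite, S is
skew-symmetric, V is symmetric, invertible, with at least one negative eigenvalue,
and R is symmetric positive definite, then for all sufficiently small ε > 0 the
perturbed Chetaev system Mq̈ + (S + εR)q̇ + Vq = 0 has an eigenvalue with strictly
positive real part. -/
theorem stmt4 {n : ℕ} (M S V R : Matrix (Fin n) (Fin n) ℝ)
    (hM : M.PosDef) (hS : Sᵀ = -S) (hV : V.IsHermitian) (hVdet : V.det ≠ 0)
    (hneg : ∃ i, hV.eigenvalues i < 0) (hR : R.PosDef) :
    ∃ ε₀ : ℝ, 0 < ε₀ ∧ ∀ ε : ℝ, 0 < ε → ε < ε₀ →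
      ∃ lam : ℂ, 0 < lam.re ∧
        (lam ^ 2 • M.map Complex.ofReal + lam • ((S + ε • R).map Complex.ofReal) +
          V.map Complex.ofReal).det = 0 := by
  refine ⟨1, one_pos, fun ε hε _ => ?_⟩
  by_contra! hcon
  obtain ⟨i₀, hi₀⟩ := hneg
  haveI : Nonempty (Fin n) := ⟨i₀⟩
  have hdet : ∀ N : Matrix (Fin n) (Fin n) ℝ, (N.map Complex.ofReal).det = (N.det : ℂ) := by
    intro N
    exact (RingHom.map_det Complex.ofRealHom N).symm
  have hMc : IsUnit (M.map Complex.ofReal).det := by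
    rw [hdet, isUnit_iff_ne_zero]
    exact_mod_cast ((isUnit_iff_isUnit_det M).mp hM.isUnit).ne_zero
  have hVT : Vᵀ = V := by
    have := hV.eq; rwa [conjTranspose_eq_transpose_of_trivial] at this
  have hMT : Mᵀ = M := by
    have := hM.isHermitian.eq; rwa [conjTranspose_eq_transpose_of_trivial] at this
  have hRT : Rᵀ = R := by
    have := hR.isHermitian.eq; rwa [conjTranspose_eq_transpose_of_trivial] at this
  -- the quadratic forms
  have hsym : ∀ (N : Matrix (Fin n) (Fin n) ℝ), Nᵀ = N → ∀ a : Fin n → ℂ,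
      (star a ⬝ᵥ (N.map Complex.ofReal *ᵥ a)).im = 0 := by
    intro N hN a
    have h := congrArg Complex.im (form_conj N a a)
    rw [hN] at h
    simp only [Complex.star_def, Complex.conj_im] at h
    linarith
  have hskew : ∀ a : Fin n → ℂ, (star a ⬝ᵥ (S.map Complex.ofReal *ᵥ a)).re = 0 := by
    intro a
    have h := congrArg Complex.re (form_conj S a a)
    have hneg : (-S).map Complex.ofReal = -(S.map Complex.ofReal) := by ext i j; simp
    rw [hS, hneg, neg_mulVec, dotProduct_neg] at h
    simp only [Complex.star_def, Complex.conj_re, Complex.neg_re] at h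
    linarith
  have hG : (S + ε • R).map Complex.ofReal =
      S.map Complex.ofReal + (ε : ℂ) • R.map Complex.ofReal := by
    ext i j; simp
  set A := sysA (M.map Complex.ofReal) ((S + ε • R).map Complex.ofReal) (V.map Complex.ofReal)
    with hAdef
  have hA2 : ∀ u, _ := sysA_snd (M.map Complex.ofReal) ((S + ε • R).map Complex.ofReal)
    (V.map Complex.ofReal) hMc
  rw [← hAdef] at hA2
  have hA1 : ∀ u, (A u).1 = u.2 := fun u => rfl
  have heig : ∀ (μ : ℂ) (x : (Fin n → ℂ) × (Fin n → ℂ)), x ≠ 0 → A x = μ • x → μ.re < 0 := by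
    rintro μ ⟨x, y⟩ hx hAx
    have hy : y = μ • x := by
      have := hA1 (x, y); rw [hAx] at this; exact this.symm
    have h2 := hA2 (x, y)
    rw [hAx] at h2
    have hx0 : x ≠ 0 := by
      rintro rfl
      apply hx
      simp [hy]
    simp only [Prod.smul_snd, hy, mulVec_smul] at h2
    have h3 : (μ ^ 2 • M.map Complex.ofReal + μ • ((S + ε • R).map Complex.ofReal) +
          V.map Complex.ofReal) *ᵥ x = 0 := by
      rw [add_mulVec, add_mulVec, smul_mulVec, smul_mulVec, pow_two, mul_smul, h2]
      abel
    have hd := exists_mulVec_eq_zero_iff.mp ⟨x, hx0, h3⟩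
    have hle : μ.re ≤ 0 := by
      by_contra hp
      exact hcon μ (not_le.mp hp) hd
    refine lt_of_le_of_ne hle fun hre => ?_
    have h4 := congrArg (fun w => (star x ⬝ᵥ w)) h3
    simp only [hG, add_mulVec, smul_mulVec, dotProduct_add, dotProduct_smul, smul_add,
      dotProduct_zero, smul_eq_mul] at h4
    have h5 := congrArg Complex.im h4
    have hm := hsym M hMT x
    have hv := hsym V hVT x
    have hr := hsym R hRT x
    have hs := hskew x
    have hrp := re_form_pos hR hx0
    simp only [Complex.add_im, Complex.mul_im, Complex.mul_re, pow_two, hm, hv, hr, hs, hre,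
      Complex.ofReal_re, Complex.ofReal_im, Complex.zero_im] at h5
    have h6 : μ.im * (ε * (star x ⬝ᵥ (R.map Complex.ofReal *ᵥ x)).re) = 0 := by
      linear_combination h5
    have h7 : μ.im = 0 := (mul_eq_zero.mp h6).resolve_right (by positivity)
    have h8 : μ = 0 := Complex.ext hre h7
    rw [h8] at hd
    simp only [ne_eq, OfNat.ofNat_ne_zero, not_false_eq_true, zero_pow, zero_smul, zero_add] at hd
    rw [hdet] at hd
    exact hVdet (by exact_mod_cast hd)
  let F : (Fin n → ℂ) × (Fin n → ℂ) → ℝ := fun u =>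
    (star u.1 ⬝ᵥ (V.map Complex.ofReal *ᵥ u.1)).re +
      (star u.2 ⬝ᵥ (M.map Complex.ofReal *ᵥ u.2)).re
  have hFc : Continuous F := by
    have hc : ∀ (N : Matrix (Fin n) (Fin n) ℂ),
        Continuous (fun a : Fin n → ℂ => (star a ⬝ᵥ (N *ᵥ a)).re) := by
      intro N
      refine Complex.continuous_re.comp ?_
      simp only [dotProduct, mulVec, Pi.star_apply]
      fun_prop
    exact ((hc _).comp continuous_fst).add ((hc _).comp continuous_snd)
  have hpol : ∀ (N : Matrix (Fin n) (Fin n) ℝ), Nᵀ = N → ∀ a b : Fin n → ℂ,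
      (star (a + b) ⬝ᵥ (N.map Complex.ofReal *ᵥ (a + b))).re -
      (star (a - b) ⬝ᵥ (N.map Complex.ofReal *ᵥ (a - b))).re =
      4 * (star a ⬝ᵥ (N.map Complex.ofReal *ᵥ b)).re := by
    intro N hN a b
    have h := congrArg Complex.re (form_conj N a b)
    rw [hN] at h
    simp only [Complex.star_def, Complex.conj_re] at h
    simp only [star_add, star_sub, mulVec_add, mulVec_sub, dotProduct_add, add_dotProduct,
      dotProduct_sub, sub_dotProduct, Complex.add_re, Complex.sub_re]
    linarith
  have hmono : ∀ u, F (u + A u) ≤ F (u - A u) := by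
    intro u
    have e1 := hpol V hVT u.1 (A u).1
    have e2 := hpol M hMT u.2 (A u).2
    have e3 := congrArg Complex.re (form_conj V u.1 u.2)
    rw [hVT] at e3
    simp only [Complex.star_def, Complex.conj_re] at e3
    rw [hA2 u, hG] at e2
    rw [hA1 u] at e1
    have hs := hskew u.2
    have hr : 0 ≤ (star u.2 ⬝ᵥ (R.map Complex.ofReal *ᵥ u.2)).re := by
      by_cases h : u.2 = 0
      · simp [h]
      · exact (re_form_pos hR h).le
    simp only [dotProduct_neg, add_mulVec, smul_mulVec, dotProduct_add, dotProduct_smul,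
      smul_eq_mul, Complex.neg_re, Complex.add_re, Complex.re_ofReal_mul, hs] at e2
    have := mul_nonneg hε.le hr
    simp only [F, Prod.fst_add, Prod.snd_add, Prod.fst_sub, Prod.snd_sub, hA1 u]
    linarith
  have key := lyapunov_nonneg A heig F hFc (by simp [F]) hmono
  have hk := key (fun i => ((hV.eigenvectorBasis i₀ i : ℝ) : ℂ), 0)
  simp only [F, re_form] at hk
  have hev := hV.eigenvalues_eq i₀
  simp at hev hk
  linarith
end

section
/- Sufficiently massive baths destabilize: Fix α < 0, B > 0 with α + B²/4 > 0, and frequencies 0 < ω₁ < ⋯ < ω_N. Then there exists M₀ > 0 such that for all choices of bath masses with mⱼ ≥ M₀ for every j, the matrix A of the isotropic oscillator–bath first-order system ż = Az has an eigenvalue λ ∈ ℂ with strictly positive real part. -/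
open Matrix

/-- Index type for the oscillator–bath first-order system: the first four
coordinates are (x, y, ẋ, ẏ) and, for each bath oscillator j, the four coordinates
are (xⱼ, yⱼ, ẋⱼ, ẏⱼ). -/
abbrev BathIdx (N : ℕ) := Fin 4 ⊕ Fin N × Fin 4

/-- The (4N+4)×(4N+4) matrix A of the isotropic oscillator–bath system
ẍ − Bẏ + αx = Σⱼ mⱼωⱼ²(xⱼ−x), ÿ + Bẋ + αy = Σⱼ mⱼωⱼ²(yⱼ−y),
ẍⱼ + ωⱼ²xⱼ = ωⱼ²x, ÿⱼ + ωⱼ²yⱼ = ωⱼ²y, written as ż = Az with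
z = (x, y, ẋ, ẏ, x₁, y₁, ẋ₁, ẏ₁, …). -/
noncomputable def bathA (N : ℕ) (α B : ℝ) (m ω : Fin N → ℝ) :
    Matrix (BathIdx N) (BathIdx N) ℝ :=
  Matrix.of fun i j =>
    match i, j with
    | .inl 0, .inl 2 => 1
    | .inl 1, .inl 3 => 1
    | .inl 2, .inl 0 => -(α + ∑ k, m k * ω k ^ 2)
    | .inl 2, .inl 3 => B
    | .inl 2, .inr (k, 0) => m k * ω k ^ 2
    | .inl 3, .inl 1 => -(α + ∑ k, m k * ω k ^ 2)
    | .inl 3, .inl 2 => -B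
    | .inl 3, .inr (k, 1) => m k * ω k ^ 2
    | .inr (k, 0), .inr (k', 2) => if k = k' then 1 else 0
    | .inr (k, 1), .inr (k', 3) => if k = k' then 1 else 0
    | .inr (k, 2), .inl 0 => ω k ^ 2
    | .inr (k, 2), .inr (k', 0) => if k = k' then -(ω k ^ 2) else 0
    | .inr (k, 3), .inl 1 => ω k ^ 2
    | .inr (k, 3), .inr (k', 1) => if k = k' then -(ω k ^ 2) else 0
    | _, _ => 0

open Polynomial in
theorem residue_contra (P Q : ℝ[X]) (hs : P.Splits) (hd : Q.degree < P.degree)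
    (hQ : 0 < Q.eval 0) (hP : 0 < P.eval 0)
    (hr : ∀ r, P.eval r = 0 → 0 < r * (P.derivative.eval r * Q.eval r)) : False := by
  classical
  have hP0 : P ≠ 0 := by rintro rfl; simp at hP
  have hnd : P.roots.Nodup := by
    rw [Multiset.nodup_iff_count_le_one]
    intro a
    rw [count_roots]
    by_contra! h
    have h' := (one_lt_rootMultiplicity_iff_isRoot hP0).1 h
    have h2 : P.derivative.eval a = 0 := h'.2
    have := hr a h'.1
    rw [h2] at this
    simp at this
  set s := P.roots.toFinset with hsdef
  have hmem : ∀ r ∈ s, P.eval r = 0 := by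
    intro r h
    have : r ∈ P.roots := by simpa [hsdef] using h
    exact (mem_roots hP0).1 this
  have hcard : s.card = P.natDegree := by
    rw [Multiset.toFinset_card_of_nodup hnd, splits_iff_card_roots.1 hs]
  have hPn : P = C P.leadingCoeff * Lagrange.nodal s id := by
    conv_lhs => rw [hs.eq_prod_roots]
    congr 1
    rw [Lagrange.nodal_eq, Finset.prod_eq_multiset_prod]
    simp [hsdef, Multiset.toFinset_val, hnd.dedup]
  have hc : P.leadingCoeff ≠ 0 := leadingCoeff_ne_zero.2 hP0
  have hx : ∀ i ∈ s, (0:ℝ) ≠ id i := by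
    rintro i hi h
    have := hmem i hi
    simp only [id] at h
    rw [← h] at this; linarith
  have hI := Lagrange.eq_interpolate (s := s) (v := id) (f := Q) Function.injective_id.injOn
    (by rw [hcard, ← degree_eq_natDegree hP0]; exact hd)
  have h0 := congrArg (eval 0) hI
  rw [Lagrange.eval_interpolate_not_at_node _ hx] at h0
  have hP0e : P.eval 0 = P.leadingCoeff * (Lagrange.nodal s id).eval 0 := by
    conv_lhs => rw [hPn]
    simp
  have key : Q.eval 0 = - (P.eval 0 * ∑ i ∈ s, Q.eval i / (i * P.derivative.eval i)) := by
    rw [h0, hP0e, Finset.mul_sum, Finset.mul_sum, ← Finset.sum_neg_distrib]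
    refine Finset.sum_congr rfl fun i hi => ?_
    have hd : P.derivative.eval i = P.leadingCoeff * (Lagrange.nodal s id).derivative.eval i := by
      conv_lhs => rw [hPn]
      simp
    have hpos := hr i (hmem i hi)
    have hi0 : i ≠ 0 := by rintro rfl; simp at hpos
    have hdn : P.derivative.eval i ≠ 0 := by intro h; rw [h] at hpos; simp at hpos
    rw [hd] at hdn
    have hdn' := right_ne_zero_of_mul hdn
    rw [Lagrange.nodalWeight_eq_eval_derivative_nodal hi, hd]
    simp only [id]
    rw [zero_sub]
    field_simp
  have hnn : 0 ≤ ∑ i ∈ s, Q.eval i / (i * P.derivative.eval i) := by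
    refine Finset.sum_nonneg fun i hi => ?_
    have hpos := hr i (hmem i hi)
    have : Q.eval i / (i * P.derivative.eval i)
        = (i * (P.derivative.eval i * Q.eval i)) / (i * P.derivative.eval i)^2 := by
      have hi0 : i ≠ 0 := by rintro rfl; simp at hpos
      have hdn : P.derivative.eval i ≠ 0 := by intro h; rw [h] at hpos; simp at hpos
      field_simp
    rw [this]
    positivity
  nlinarith [mul_nonneg hP.le hnn]

open Polynomial in
noncomputable def polyQ {N : ℕ} (ω : Fin N → ℝ) : ℝ[X] := ∏ j, (C (ω j ^ 2) - X ^ 2)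

open Polynomial in
noncomputable def polyP {N : ℕ} (α B : ℝ) (m ω : Fin N → ℝ) : ℝ[X] :=
  polyQ ω * (X ^ 2 + C B * X - C α) +
    ∑ j, C (m j * ω j ^ 2) * X ^ 2 * ∏ k ∈ Finset.univ.erase j, (C (ω k ^ 2) - X ^ 2)

open Polynomial in
theorem natDegree_fac (a : ℝ) : (C a - X ^ 2 : ℝ[X]).natDegree = 2 := by
  compute_degree!

open Polynomial in
theorem degree_lt {N : ℕ} (α B : ℝ) (m ω : Fin N → ℝ) :
    (polyQ ω).degree < (polyP α B m ω).degree := by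
  have hne : ∀ a : ℝ, (C a - X ^ 2 : ℝ[X]) ≠ 0 := fun a h => by
    have := natDegree_fac a; rw [h] at this; simp at this
  have hQ0 : polyQ ω ≠ 0 := Finset.prod_ne_zero_iff.2 fun j _ => hne _
  have hQ : (polyQ ω).natDegree = 2 * N := by
    rw [polyQ, natDegree_prod _ _ fun j _ => hne _]
    simp only [natDegree_fac]
    simp [mul_comm]
  have hq : (X ^ 2 + C B * X - C α : ℝ[X]).natDegree = 2 := by compute_degree!
  have hq0 : (X ^ 2 + C B * X - C α : ℝ[X]) ≠ 0 := fun h => by rw [h] at hq; simp at hq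
  have h1 : (polyQ ω * (X ^ 2 + C B * X - C α)).natDegree = 2 * N + 2 := by
    rw [natDegree_mul hQ0 hq0, hQ, hq]
  have h2 : (∑ j, C (m j * ω j ^ 2) * X ^ 2 *
      ∏ k ∈ Finset.univ.erase j, (C (ω k ^ 2) - X ^ 2) : ℝ[X]).natDegree ≤ 2 * N := by
    refine natDegree_sum_le_of_forall_le _ _ fun j _ => ?_
    have hp : (∏ k ∈ Finset.univ.erase j, (C (ω k ^ 2) - X ^ 2) : ℝ[X]).natDegree
        = (N - 1) * 2 := by
      rw [natDegree_prod _ _ fun j _ => hne _]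
      simp only [natDegree_fac]
      simp
    have hN : 0 < N := j.pos
    refine natDegree_mul_le.trans ?_
    rw [hp]
    have := natDegree_C_mul_X_pow_le (m j * ω j ^ 2) 2
    omega
  have h3 : (polyP α B m ω).natDegree = 2 * N + 2 := by
    rw [polyP, natDegree_add_eq_left_of_natDegree_lt (by omega), h1]
  apply degree_lt_degree
  omega

open Polynomial in
theorem aeval_polyQ {K : Type*} [Field K] [Algebra ℝ K] {N : ℕ} (ω : Fin N → ℝ) (x : K) :
    aeval x (polyQ ω) = ∏ j, (algebraMap ℝ K (ω j) ^ 2 - x ^ 2) := by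
  simp [polyQ, map_prod]

open Polynomial in
theorem aeval_polyP {K : Type*} [Field K] [Algebra ℝ K] {N : ℕ} (α B : ℝ) (m ω : Fin N → ℝ)
    (x : K) (h : ∀ j, algebraMap ℝ K (ω j) ^ 2 - x ^ 2 ≠ 0) :
    aeval x (polyP α B m ω) = (x ^ 2 + algebraMap ℝ K B * x - algebraMap ℝ K α +
      ∑ j, algebraMap ℝ K (m j) * algebraMap ℝ K (ω j) ^ 2 * x ^ 2 /
        (algebraMap ℝ K (ω j) ^ 2 - x ^ 2)) * aeval x (polyQ ω) := by
  rw [polyP, map_add, map_mul, add_mul, mul_comm (aeval x (polyQ ω)), Finset.sum_mul, map_sum]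
  congr 1
  · simp
  · refine Finset.sum_congr rfl fun j _ => ?_
    rw [aeval_polyQ, ← Finset.mul_prod_erase _ _ (Finset.mem_univ j)]
    simp only [map_mul, map_prod, map_sub, map_pow, aeval_C, aeval_X]
    field_simp [h j]

open Polynomial in
theorem polyQ_ne {N : ℕ} (α B : ℝ) (m ω : Fin N → ℝ) (hω : ∀ j, 0 < ω j)
    (hmono : StrictMono ω) (hm : ∀ j, 0 < m j) (r : ℝ) (hr : (polyP α B m ω).eval r = 0)
    (j : Fin N) : ω j ^ 2 - r ^ 2 ≠ 0 := by
  intro h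
  have hrj : r ^ 2 = ω j ^ 2 := by linarith
  rw [polyP, eval_add, eval_finsetSum, Finset.sum_eq_single j] at hr
  · have hQ : (polyQ ω).eval r = 0 := by
      rw [polyQ, eval_prod]
      exact Finset.prod_eq_zero (Finset.mem_univ j) (by simp [hrj])
    rw [eval_mul, hQ, zero_mul, zero_add] at hr
    simp only [eval_mul, eval_C, eval_pow, eval_X, eval_prod, eval_sub, hrj] at hr
    have := hω j
    have := hm j
    rcases mul_eq_zero.1 hr with h1 | h1
    · have : 0 < m j * ω j ^ 2 * ω j ^ 2 := by positivity
      linarith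
    · obtain ⟨k, hk, hk2⟩ := Finset.prod_eq_zero_iff.1 h1
      have : ω k = ω j := by
        have h3 : ω k ^ 2 = ω j ^ 2 := by linarith
        exact (pow_left_inj₀ (hω k).le (hω j).le two_ne_zero).1 h3
      exact (Finset.mem_erase.1 hk).1 (hmono.injective this)
  · intro k _ hk
    rw [eval_mul, eval_prod]
    apply mul_eq_zero_of_right
    exact Finset.prod_eq_zero (i := j) (by simp [hk.symm]) (by simp [hrj])
  · simp

open Polynomial in
theorem deriv_polyP {N : ℕ} (α B : ℝ) (m ω : Fin N → ℝ) (r : ℝ)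
    (hr : (polyP α B m ω).eval r = 0) (h : ∀ j, ω j ^ 2 - r ^ 2 ≠ 0) :
    (polyP α B m ω).derivative.eval r = (2 * r + B +
      ∑ j, m j * ω j ^ 2 * (2 * r * ω j ^ 2) / (ω j ^ 2 - r ^ 2) ^ 2) * (polyQ ω).eval r := by
  have hf : HasDerivAt (fun x : ℝ => x ^ 2 + B * x - α +
      ∑ j, m j * ω j ^ 2 * x ^ 2 / (ω j ^ 2 - x ^ 2)) (2 * r + B +
      ∑ j, m j * ω j ^ 2 * (2 * r * ω j ^ 2) / (ω j ^ 2 - r ^ 2) ^ 2) r := by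
    apply HasDerivAt.add
    · have := (((hasDerivAt_pow 2 r).add ((hasDerivAt_id r).const_mul B)).sub_const α)
      refine HasDerivAt.congr_deriv this ?_
      norm_num
    · apply HasDerivAt.fun_sum
      intro j _
      have := ((hasDerivAt_pow 2 r).const_mul (m j * ω j ^ 2)).div
        ((hasDerivAt_pow 2 r).const_sub (ω j ^ 2)) (h j)
      refine HasDerivAt.congr_deriv this ?_
      push_cast
      ring
  have hFQ := hf.mul ((polyQ ω).hasDerivAt r)
  have hev : (fun x => (polyP α B m ω).eval x) =ᶠ[nhds r] (fun x : ℝ => (x ^ 2 + B * x - α +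
      ∑ j, m j * ω j ^ 2 * x ^ 2 / (ω j ^ 2 - x ^ 2))  * (polyQ ω).eval x) := by
    have : ∀ᶠ x in nhds r, ∀ j, ω j ^ 2 - x ^ 2 ≠ 0 := by
      rw [Filter.eventually_all]
      intro j
      have hc : Continuous fun x : ℝ => ω j ^ 2 - x ^ 2 := by fun_prop
      exact hc.continuousAt.eventually_ne (h j)
    filter_upwards [this] with x hx
    have := aeval_polyP (K := ℝ) α B m ω x (by simpa using hx)
    simpa [coe_aeval_eq_eval] using this
  have h2 := HasDerivAt.congr_of_eventuallyEq hFQ hev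
  rw [((polyP α B m ω).hasDerivAt r).unique h2]
  have hQ : (polyQ ω).eval r ≠ 0 := by
    rw [polyQ, eval_prod]
    exact Finset.prod_ne_zero_iff.2 fun j _ => by simpa using h j
  have h0 := hev.self_of_nhds
  simp only [hr] at h0
  rw [(mul_eq_zero.1 h0.symm).resolve_right hQ]
  ring

open Polynomial in
theorem root_sign {N : ℕ} (hN : 0 < N) (α B : ℝ) (m ω : Fin N → ℝ) (hα : α < 0) (hB : 0 < B)
    (hω : ∀ j, 0 < ω j) (hmono : StrictMono ω) (M : ℝ) (hM : 0 < M)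
    (hM1 : B ^ 2 ≤ -4 * α * M) (hM2 : -α ≤ M * ω ⟨0, hN⟩ ^ 2) (hm : ∀ j, M ≤ m j)
    (r : ℝ) (hr : (polyP α B m ω).eval r = 0) :
    0 < r * ((polyP α B m ω).derivative.eval r * (polyQ ω).eval r) := by
  have hmp : ∀ j, 0 < m j := fun j => hM.trans_le (hm j)
  have h := polyQ_ne α B m ω hω hmono hmp r hr
  have hQ : (polyQ ω).eval r ≠ 0 := by
    rw [polyQ, eval_prod]
    exact Finset.prod_ne_zero_iff.2 fun j _ => by simpa using h j
  have hf0 : r ^ 2 + B * r - α + ∑ j, m j * ω j ^ 2 * r ^ 2 / (ω j ^ 2 - r ^ 2) = 0 := by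
    have := aeval_polyP (K := ℝ) α B m ω r (by simpa using h)
    simp only [coe_aeval_eq_eval, hr, Algebra.algebraMap_self, RingHom.id_apply] at this
    exact (mul_eq_zero.1 this.symm).resolve_right hQ
  rw [deriv_polyP α B m ω r hr h]
  set S := ∑ j, m j * ω j ^ 2 * (2 * r * ω j ^ 2) / (ω j ^ 2 - r ^ 2) ^ 2 with hS
  suffices hh : 0 < r * (2 * r + B + S) by
    have : 0 < (polyQ ω).eval r ^ 2 := by positivity
    calc 0 < (r * (2 * r + B + S)) * (polyQ ω).eval r ^ 2 := by positivity
      _ = _ := by ring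
  have hrS : r * S = 2 * (∑ j, m j * ω j ^ 2 * r ^ 2 / (ω j ^ 2 - r ^ 2)) +
      ∑ j, 2 * m j * ω j ^ 2 * (r ^ 4 / (ω j ^ 2 - r ^ 2) ^ 2) := by
    rw [hS, Finset.mul_sum, Finset.mul_sum, ← Finset.sum_add_distrib]
    refine Finset.sum_congr rfl fun j _ => ?_
    have := h j
    field_simp
    ring
  set z : Fin N := ⟨0, hN⟩ with hz
  have hzle : ∀ j, ω z ≤ ω j := fun j => hmono.monotone (by simp [hz, Fin.le_def])
  rcases lt_trichotomy r 0 with hneg | h0 | hpos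
  · rcases lt_or_gt_of_ne (h z) with hlt | hgt
    · have hsum : 2 * m z * ω z ^ 2 * (r ^ 4 / (ω z ^ 2 - r ^ 2) ^ 2) ≤
          ∑ j, 2 * m j * ω j ^ 2 * (r ^ 4 / (ω j ^ 2 - r ^ 2) ^ 2) :=
        Finset.single_le_sum (f := fun j => 2 * m j * ω j ^ 2 * (r ^ 4 / (ω j ^ 2 - r ^ 2) ^ 2))
          (fun j _ => by have := hmp j; positivity) (Finset.mem_univ z)
      have h1 : 1 ≤ r ^ 4 / (ω z ^ 2 - r ^ 2) ^ 2 := by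
        have hp : 0 < (ω z ^ 2 - r ^ 2) ^ 2 := sq_pos_of_ne_zero (h z)
        rw [one_le_div hp]
        nlinarith [sq_nonneg (ω z), sq_nonneg r]
      have h2 : 2 * M * ω z ^ 2 ≤ 2 * m z * ω z ^ 2 * (r ^ 4 / (ω z ^ 2 - r ^ 2) ^ 2) := by
        have hmz := hm z
        calc 2 * M * ω z ^ 2 ≤ 2 * m z * ω z ^ 2 := by gcongr
          _ ≤ _ := le_mul_of_one_le_right (by have := hmp z; positivity) h1
      have := mul_neg_of_pos_of_neg hB hneg
      nlinarith
    · exfalso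
      have hpj : ∀ j, 0 < ω j ^ 2 - r ^ 2 := fun j => by
        have := pow_le_pow_left₀ (hω z).le (hzle j) 2
        linarith
      have hsum : m z * ω z ^ 2 * r ^ 2 / (ω z ^ 2 - r ^ 2) ≤
          ∑ j, m j * ω j ^ 2 * r ^ 2 / (ω j ^ 2 - r ^ 2) :=
        Finset.single_le_sum (f := fun j => m j * ω j ^ 2 * r ^ 2 / (ω j ^ 2 - r ^ 2))
          (fun j _ => by have := hmp j; have := hpj j; positivity) (Finset.mem_univ z)
      have h1 : M * r ^ 2 ≤ m z * ω z ^ 2 * r ^ 2 / (ω z ^ 2 - r ^ 2) := by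
        rw [le_div_iff₀ hgt]
        have h3 : M * r ^ 2 ≤ m z * r ^ 2 := by have := hm z; gcongr
        have h4 : 0 ≤ M * r ^ 2 := by positivity
        nlinarith [mul_le_mul_of_nonneg_right h3 (sq_nonneg (ω z)), mul_nonneg h4 (sq_nonneg r)]
      have h5 : 0 ≤ M * (M * r ^ 2 + B * r - α) := by
        nlinarith [sq_nonneg (2 * M * r + B)]
      have h6 := nonneg_of_mul_nonneg_right h5 hM
      have h7 : 0 < r ^ 2 := sq_pos_of_ne_zero hneg.ne
      linarith
  · exfalso
    subst h0
    simp at hf0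
    linarith
  · have : 0 ≤ S := Finset.sum_nonneg fun j _ => by have := hmp j; positivity
    positivity

open Polynomial in
theorem exists_nonreal {N : ℕ} (α B : ℝ) (m ω : Fin N → ℝ) (hα : α < 0)
    (hω : ∀ j, 0 < ω j)
    (hr : ∀ r, (polyP α B m ω).eval r = 0 →
      0 < r * ((polyP α B m ω).derivative.eval r * (polyQ ω).eval r)) :
    ∃ ν : ℂ, aeval ν (polyP α B m ω) = 0 ∧ ν.im < 0 := by
  by_contra! hcon
  have hre : ∀ ν : ℂ, aeval ν (polyP α B m ω) = 0 → ν.im = 0 := by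
    intro ν hν
    refine le_antisymm ?_ (hcon ν hν)
    have h2 : aeval ((starRingEnd ℂ) ν) (polyP α B m ω) = 0 := by
      rw [aeval_conj, hν, map_zero]
    have := hcon _ h2
    simp at this
    exact this
  have hs : (polyP α B m ω).Splits := by
    refine Splits.of_splits_map (algebraMap ℝ ℂ) (IsAlgClosed.splits _) fun a ha => ?_
    have h1 := (mem_roots'.1 ha).2
    rw [IsRoot, eval_map_algebraMap] at h1
    exact ⟨a.re, Complex.ext (by simp) (by simp [hre a h1])⟩
  have hQ0 : 0 < (polyQ ω).eval 0 := by
    rw [polyQ, eval_prod]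
    exact Finset.prod_pos fun j _ => by have := hω j; simp; positivity
  refine residue_contra _ _ hs (degree_lt α B m ω) hQ0 ?_ hr
  have : (polyP α B m ω).eval 0 = (polyQ ω).eval 0 * (-α) := by
    simp [polyP, eval_finsetSum]
  rw [this]
  exact mul_pos hQ0 (by linarith)

theorem eig_of_root {N : ℕ} (α B : ℝ) (m ω : Fin N → ℝ) (lam : ℂ)
    (h : ∀ j, lam ^ 2 + (ω j : ℂ) ^ 2 ≠ 0)
    (he : lam ^ 2 + Complex.I * B * lam + α +
      ∑ j, (m j : ℂ) * (ω j : ℂ) ^ 2 * lam ^ 2 / (lam ^ 2 + (ω j : ℂ) ^ 2) = 0) :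
    (lam • (1 : Matrix (BathIdx N) (BathIdx N) ℂ) -
          (bathA N α B m ω).map Complex.ofReal).det = 0 := by
  classical
  rw [← Matrix.exists_mulVec_eq_zero_iff]
  let g : Fin 4 → ℂ := ![1, -Complex.I, lam, -Complex.I * lam]
  let v : BathIdx N → ℂ := Sum.elim g
    (fun p => (ω p.1 : ℂ) ^ 2 / (lam ^ 2 + (ω p.1 : ℂ) ^ 2) * g p.2)
  have hsum : ∑ j, (m j : ℂ) * (ω j : ℂ) ^ 2 * lam ^ 2 / (lam ^ 2 + (ω j : ℂ) ^ 2) =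
      ∑ j, (m j : ℂ) * (ω j : ℂ) ^ 2 -
      ∑ j, (m j : ℂ) * (ω j : ℂ) ^ 2 * ((ω j : ℂ) ^ 2 / (lam ^ 2 + (ω j : ℂ) ^ 2)) := by
    rw [← Finset.sum_sub_distrib]
    refine Finset.sum_congr rfl fun j _ => ?_
    have := h j
    field_simp
    ring
  rw [hsum] at he
  refine ⟨v, fun h0 => ?_, ?_⟩
  · have := congrFun h0 (.inl 0)
    simp [v, g] at this
  · rw [Matrix.sub_mulVec, Matrix.smul_mulVec, Matrix.one_mulVec, sub_eq_zero]
    funext i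
    rcases i with i | ⟨k, i⟩
    · fin_cases i <;>
      simp [Matrix.mulVec, dotProduct, bathA, v, g, Fintype.sum_sum_type, Fintype.sum_prod_type,
        Fin.sum_univ_four]
      · ring
      · linear_combination he
      · simp only [← mul_assoc, ← Finset.sum_mul]
        linear_combination (-Complex.I) * he + B * lam * Complex.I_sq
    · have := h k
      fin_cases i <;>
      simp [Matrix.mulVec, dotProduct, bathA, v, g, Fintype.sum_sum_type, Fintype.sum_prod_type,
        Fin.sum_univ_four, apply_ite Complex.ofReal, ite_mul]
      all_goals field_simp
      all_goals ring

/-- Sufficiently massive baths destabilize: for a gyroscopically stable oscillator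
(α < 0, B > 0, α + B²/4 > 0) and fixed bath frequencies 0 < ω₁ < ⋯ < ω_N, there is
an M₀ > 0 such that whenever all bath masses satisfy mⱼ ≥ M₀, the oscillator–bath
matrix A has an eigenvalue with strictly positive real part. -/
theorem stmt12 (N : ℕ) (hN : 0 < N) (α B : ℝ) (ω : Fin N → ℝ)
    (hα : α < 0) (hB : 0 < B) (hgyro : 0 < α + B ^ 2 / 4)
    (hω : ∀ j, 0 < ω j) (hmono : StrictMono ω) :
    ∃ M₀ : ℝ, 0 < M₀ ∧ ∀ m : Fin N → ℝ, (∀ j, M₀ ≤ m j) →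
      ∃ lam : ℂ,
        (lam • (1 : Matrix (BathIdx N) (BathIdx N) ℂ) -
          (bathA N α B m ω).map Complex.ofReal).det = 0 ∧
        0 < lam.re := by
  have hz := hω ⟨0, hN⟩
  have hα' : 0 < -α := by linarith
  have a1 : 0 ≤ B ^ 2 / (4 * -α) := by positivity
  have a2 : 0 ≤ -α / ω ⟨0, hN⟩ ^ 2 := by positivity
  refine ⟨B ^ 2 / (4 * -α) + -α / ω ⟨0, hN⟩ ^ 2 + 1, by positivity, fun m hm => ?_⟩
  set M := B ^ 2 / (4 * -α) + -α / ω ⟨0, hN⟩ ^ 2 + 1 with hMdef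
  have hM : 0 < M := by positivity
  have hM1 : B ^ 2 ≤ -4 * α * M := by
    have : B ^ 2 / (4 * -α) ≤ M := by linarith
    rw [div_le_iff₀ (by positivity)] at this
    linarith
  have hM2 : -α ≤ M * ω ⟨0, hN⟩ ^ 2 := by
    have : -α / ω ⟨0, hN⟩ ^ 2 ≤ M := by linarith
    rwa [div_le_iff₀ (by positivity)] at this
  obtain ⟨ν, hν, him⟩ := exists_nonreal α B m ω hα hω
    (root_sign hN α B m ω hα hB hω hmono M hM hM1 hM2 hm)
  have hne : ∀ j, (ω j : ℂ) ^ 2 - ν ^ 2 ≠ 0 := by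
    intro j h
    have h2 : ((ω j : ℂ) - ν) * ((ω j : ℂ) + ν) = 0 := by linear_combination h
    rcases mul_eq_zero.1 h2 with h3 | h3 <;>
    · have := congrArg Complex.im h3
      simp at this
      linarith
  have hQ : Polynomial.aeval ν (polyQ ω) ≠ 0 := by
    rw [aeval_polyQ]
    exact Finset.prod_ne_zero_iff.2 fun j _ => hne j
  rw [aeval_polyP α B m ω ν hne] at hν
  have he := (mul_eq_zero.1 hν).resolve_right hQ
  simp only [Complex.coe_algebraMap] at he
  have hsq : (Complex.I * ν) ^ 2 = - ν ^ 2 := by rw [mul_pow, Complex.I_sq]; ring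
  refine ⟨Complex.I * ν, eig_of_root α B m ω _ (fun j h => hne j ?_) ?_, by simpa using him⟩
  · rw [hsq] at h
    linear_combination h
  · rw [hsq]
    have hs : ∑ j, (m j : ℂ) * (ω j : ℂ) ^ 2 * (-ν ^ 2) / (-ν ^ 2 + (ω j : ℂ) ^ 2) =
        -∑ j, (m j : ℂ) * (ω j : ℂ) ^ 2 * ν ^ 2 / ((ω j : ℂ) ^ 2 - ν ^ 2) := by
      rw [← Finset.sum_neg_distrib]
      refine Finset.sum_congr rfl fun j _ => ?_
      rw [neg_add_eq_sub]
      ring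
    rw [hs]
    linear_combination -he + B * ν * Complex.I_sq
end
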